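/- Let A(Γ₀) be a dihedral Artin-Tits group with m < ∞, let w ∈ Ω(Γ₀), let g be the element of A(Γ₀) represented by w, and let (g₁, g₂) be the left normal decomposition of g. Then there exist positive words w₁ and w₂ representing g₁ and g₂ respectively such that w →_{2⋆} w₁w₂⁻¹. -/

import Mathlib

namespace ArtinTits

open Classical List

variable {S : Type*}

/-- A word over `S ∪ S⁻¹`: a list of letters, each a generator together with a sign
(`true` = the generator itself, `false` = its formal inverse). -/
abbrev Word (S : Type*) := List (S × Bool)

/-- The formal inverse of a word. -/
def wordInv (w : Word S) : Word S := w.reverse.map fun l => (l.1, !l.2)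

/-- `[x,y,j⟩`: the alternating positive word `xyxy⋯` with `j` letters, beginning with `x`. -/
def altWord (x y : S) : ℕ → Word S
  | 0 => []
  | j + 1 => (x, true) :: altWord y x j

/-- `⟨x,y,j]`: the alternating positive word `⋯xy` with `j` letters, ending with `y`. -/
def altWordR (x y : S) (j : ℕ) : Word S := (altWord y x j).reverse

/-- The data of a labelled finite complete simplicial graph `Γ₀`: a symmetric label map
with values in `{2,3,…} ∪ {∞}` on pairs of distinct vertices. -/
structure ArtinData (S : Type*) where
  m : S → S → ℕ∞
  symm : ∀ s t, m s t = m t s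
  two_le : ∀ s t : S, s ≠ t → 2 ≤ m s t

/-- `u = v` is a defining (braid) relation of the Artin–Tits presentation. -/
def IsRel (A : ArtinData S) (u v : Word S) : Prop :=
  ∃ (s t : S) (k : ℕ), s ≠ t ∧ A.m s t = (k : ℕ∞) ∧
    u = altWord s t k ∧ v = altWord t s k

/-- The relator set of the Artin–Tits presentation, inside the free group. -/
def rels (A : ArtinData S) : Set (FreeGroup S) :=
  {x | ∃ u v : Word S, IsRel A u v ∧ x = FreeGroup.mk u * (FreeGroup.mk v)⁻¹}

/-- The Artin–Tits group `A(Γ₀)` of the presentation. -/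
abbrev ArtinGroup (A : ArtinData S) := PresentedGroup (rels A)

/-- `w̄`: the element of the Artin–Tits group represented by the word `w`. -/
def wbar (A : ArtinData S) (w : Word S) : ArtinGroup A :=
  PresentedGroup.mk (rels A) (FreeGroup.mk w)

/-! ### Special transformations -/

/-- Type 0: delete a factor `s s⁻¹` or `s⁻¹ s`. -/
def Step0 (w w' : Word S) : Prop :=
  ∃ (w₁ w₂ : Word S) (s : S) (b : Bool),
    w = w₁ ++ [(s, b), (s, !b)] ++ w₂ ∧ w' = w₁ ++ w₂

/-- Type ∞: insert a factor `s s⁻¹` or `s⁻¹ s` (the inverse of type 0). -/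
def StepInfty (w w' : Word S) : Prop := Step0 w' w

/-- Type 1: replace a factor `v` by `u`, or `v⁻¹` by `u⁻¹`, where `u = v` is a defining
relation. -/
def Step1 (A : ArtinData S) (w w' : Word S) : Prop :=
  ∃ (w₁ w₂ u v : Word S), IsRel A u v ∧
    ((w = w₁ ++ v ++ w₂ ∧ w' = w₁ ++ u ++ w₂) ∨
     (w = w₁ ++ wordInv v ++ w₂ ∧ w' = w₁ ++ wordInv u ++ w₂))

/-- Type 2r: for a defining relation `u₁u₂ = v₁v₂` with `u₁, v₁` non-empty, replace a factor
`v₁⁻¹ u₁` by `v₂ u₂⁻¹`. -/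
def Step2r (A : ArtinData S) (w w' : Word S) : Prop :=
  ∃ (w₁ w₂ u₁ u₂ v₁ v₂ : Word S), IsRel A (u₁ ++ u₂) (v₁ ++ v₂) ∧
    u₁ ≠ [] ∧ v₁ ≠ [] ∧
    w = w₁ ++ wordInv v₁ ++ u₁ ++ w₂ ∧ w' = w₁ ++ v₂ ++ wordInv u₂ ++ w₂

/-- Type 2l: for a defining relation `u₁u₂ = v₁v₂` with `u₂, v₂` non-empty, replace a factor
`v₂ u₂⁻¹` by `v₁⁻¹ u₁`. -/
def Step2l (A : ArtinData S) (w w' : Word S) : Prop :=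
  ∃ (w₁ w₂ u₁ u₂ v₁ v₂ : Word S), IsRel A (u₁ ++ u₂) (v₁ ++ v₂) ∧
    u₂ ≠ [] ∧ v₂ ≠ [] ∧
    w = w₁ ++ v₂ ++ wordInv u₂ ++ w₂ ∧ w' = w₁ ++ wordInv v₁ ++ u₁ ++ w₂

/-- Type 2: a type 2r or type 2l transformation. -/
def Step2 (A : ArtinData S) (w w' : Word S) : Prop := Step2r A w w' ∨ Step2l A w w'

/-- `p` is the greatest (longest) common left factor of `x` and `y`. -/
def IsLCPrefix (p x y : Word S) : Prop :=
  p <+: x ∧ p <+: y ∧ ∀ q : Word S, q <+: x → q <+: y → q.length ≤ p.length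

/-- `p` is the greatest (longest) common right factor of `x` and `y`. -/
def IsLCSuffix (p x y : Word S) : Prop :=
  p <:+ x ∧ p <:+ y ∧ ∀ q : Word S, q <:+ x → q <:+ y → q.length ≤ p.length

/-- Type 2r⋆ : a type 2r transformation `w₁ v⁻¹ v' w₂ → w₁ u (u')⁻¹ w₂` (with `vu = v'u'` a
defining relation) such that `v` is the greatest common left factor of `vu` and `v w₁⁻¹`, and
`v'` is the greatest common left factor of `v'u'` and `v' w₂`. -/
def Step2rStar (A : ArtinData S) (w w' : Word S) : Prop :=
  ∃ (w₁ w₂ v u v' u' : Word S), IsRel A (v ++ u) (v' ++ u') ∧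
    v ≠ [] ∧ v' ≠ [] ∧
    w = w₁ ++ wordInv v ++ v' ++ w₂ ∧
    w' = w₁ ++ u ++ wordInv u' ++ w₂ ∧
    IsLCPrefix v (v ++ u) (v ++ wordInv w₁) ∧
    IsLCPrefix v' (v' ++ u') (v' ++ w₂)

/-- Type 2l⋆ : a type 2l transformation `w₁ v (v')⁻¹ w₂ → w₁ u⁻¹ u' w₂` (with `uv = u'v'` a
defining relation) such that `v` is the greatest common right factor of `uv` and `w₁ v`, and
`v'` is the greatest common right factor of `u'v'` and `w₂⁻¹ v'`. -/
def Step2lStar (A : ArtinData S) (w w' : Word S) : Prop :=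
  ∃ (w₁ w₂ v u v' u' : Word S), IsRel A (u ++ v) (u' ++ v') ∧
    v ≠ [] ∧ v' ≠ [] ∧
    w = w₁ ++ v ++ wordInv v' ++ w₂ ∧
    w' = w₁ ++ wordInv u ++ u' ++ w₂ ∧
    IsLCSuffix v (u ++ v) (w₁ ++ v) ∧
    IsLCSuffix v' (u' ++ v') (wordInv w₂ ++ v')

/-- Type 2⋆ : a type 2r⋆ or type 2l⋆ transformation. -/
def Step2Star (A : ArtinData S) (w w' : Word S) : Prop :=
  Step2rStar A w w' ∨ Step2lStar A w w'

/-- `w →_{0,1,2} w'`. -/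
def Steps012 (A : ArtinData S) : Word S → Word S → Prop :=
  Relation.ReflTransGen fun x y => Step0 x y ∨ Step1 A x y ∨ Step2 A x y

/-- `w →_{0,1,2⋆} w'`. -/
def Steps012Star (A : ArtinData S) : Word S → Word S → Prop :=
  Relation.ReflTransGen fun x y => Step0 x y ∨ Step1 A x y ∨ Step2Star A x y

/-- `w →_{2⋆} w'`. -/
def Steps2Star (A : ArtinData S) : Word S → Word S → Prop :=
  Relation.ReflTransGen (Step2Star A)

/-- `w →_{1,2⋆} w'`. -/
def Steps12Star (A : ArtinData S) : Word S → Word S → Prop :=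
  Relation.ReflTransGen fun x y => Step1 A x y ∨ Step2Star A x y

/-- `w →_{1,2} w'`. -/
def Steps12 (A : ArtinData S) : Word S → Word S → Prop :=
  Relation.ReflTransGen fun x y => Step1 A x y ∨ Step2 A x y

/-! ### Classes of words -/

/-- A positive word: written over `S`. -/
def Positive (w : Word S) : Prop := ∀ l ∈ w, l.2 = true

/-- A negative word: written over `S⁻¹`. -/
def Negative (w : Word S) : Prop := ∀ l ∈ w, l.2 = false

/-- A signed word: positive or negative. -/
def Signed (w : Word S) : Prop := Positive w ∨ Negative w

/-- An unsigned word: neither positive nor negative. -/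
def Unsigned (w : Word S) : Prop := ¬ Positive w ∧ ¬ Negative w

/-- A freely reduced word: no factor `s s⁻¹` or `s⁻¹ s`. -/
def FreelyReduced (w : Word S) : Prop :=
  ∀ (w₁ w₂ : Word S) (s : S) (b : Bool), w ≠ w₁ ++ [(s, b), (s, !b)] ++ w₂

/-- A square-free word: no factor `aa`. -/
def SquareFree (w : Word S) : Prop := ∀ a : S × Bool, ¬ [a, a] <:+: w

/-- `p̃(w)`: the length of the longest square-free positive factor of `w`. -/
noncomputable def ptilde (w : Word S) : ℕ :=
  sSup {n | ∃ v : Word S, v <:+: w ∧ Positive v ∧ SquareFree v ∧ v.length = n}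

/-- `ñ(w)`: the length of the longest negative factor of `w` whose formal inverse is
square-free. -/
noncomputable def ntilde (w : Word S) : ℕ :=
  sSup {n | ∃ v : Word S, v <:+: w ∧ Negative v ∧ SquareFree (wordInv v) ∧ v.length = n}

/-- `p(w) = min(p̃(w), m)`. -/
noncomputable def pfun (M : ℕ) (w : Word S) : ℕ := min (ptilde w) M

/-- `n(w) = min(ñ(w), m)`. -/
noncomputable def nfun (M : ℕ) (w : Word S) : ℕ := min (ntilde w) M

/-- `Ω(Γ₀)` (for a dihedral presentation with label `M`): the freely reduced words with
`max(p(w), n(w)) < M`. -/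
def Omega (M : ℕ) (w : Word S) : Prop :=
  FreelyReduced w ∧ max (pfun M w) (nfun M w) < M

/-- A signed square-free word (square-free positive, or negative with square-free inverse). -/
def SignedSF (w : Word S) : Prop :=
  (Positive w ∧ SquareFree w) ∨ (Negative w ∧ SquareFree (wordInv w))

/-- `v` is the maximal square-free signed left factor of `w`. -/
def MaxSignedSFPrefix (v w : Word S) : Prop :=
  v <+: w ∧ SignedSF v ∧ ∀ v' : Word S, v' <+: w → SignedSF v' → v'.length ≤ v.length

/-- `(v₁, …, v_k)` is the `⋆`-decomposition of `w`: the `v_i` are non-empty, `w = v₁⋯v_k`,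
and each `v_i` is the maximal square-free signed left factor of `v_i⋯v_k`. -/
def StarDecomp (w : Word S) (L : List (Word S)) : Prop :=
  w = L.flatten ∧ (∀ v ∈ L, v ≠ ([] : Word S)) ∧
    ∀ i (h : i < L.length), MaxSignedSFPrefix (L.get ⟨i, h⟩) ((L.drop i).flatten)

/-! ### Groups, parabolic subgroups, geodesics -/

/-- A word written over `T ∪ T⁻¹` for a subset `T` of the generators. -/
def WordOver (T : Set S) (w : Word S) : Prop := ∀ l ∈ w, l.1 ∈ T

/-- The standard parabolic subgroup `A_T` generated by the image of `T ⊆ S`. -/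
def parab (A : ArtinData S) (T : Set S) : Subgroup (ArtinGroup A) :=
  Subgroup.closure {x | ∃ s ∈ T, x = wbar A [(s, true)]}

/-- A geodesic word: of minimal length among all words representing the same element. -/
def Geodesic (A : ArtinData S) (w : Word S) : Prop :=
  ∀ w' : Word S, wbar A w' = wbar A w → w.length ≤ w'.length

/-- A word over `T ∪ T⁻¹` that is geodesic among the words over `T ∪ T⁻¹` representing the
same element. -/
def GeodesicOver (A : ArtinData S) (T : Set S) (w : Word S) : Prop :=
  WordOver T w ∧
    ∀ w' : Word S, WordOver T w' → wbar A w' = wbar A w → w.length ≤ w'.length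

/-- The length of a group element: the length of any geodesic representative word. -/
noncomputable def elLength (A : ArtinData S) (g : ArtinGroup A) : ℕ :=
  sInf {n | ∃ w : Word S, wbar A w = g ∧ w.length = n}

/-- A positive element: one represented by a positive word. -/
def IsPosElt (A : ArtinData S) (g : ArtinGroup A) : Prop :=
  ∃ w : Word S, Positive w ∧ wbar A w = g

/-- An `H`-transversal: a subset containing `1` and exactly one element of each left
`H`-coset. -/
def IsLeftTransversal {G : Type*} [Group G] (H : Subgroup G) (T : Set G) : Prop :=
  (1 : G) ∈ T ∧ ∀ g : G, ∃! x, x ∈ T ∧ g⁻¹ * x ∈ H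

/-! ### Properties H, H⁺, H# -/

/-- Property `H`: `w →_{0,1,2} ε ↔ w̄ = 1`. -/
def PropertyH (A : ArtinData S) : Prop :=
  ∀ w : Word S, Steps012 A w [] ↔ wbar A w = 1

/-- Property `H⁺`: every word representing an element of a standard parabolic subgroup
`A_{S₀}` can be transformed by `→_{0,1,2⋆}` into a word over `S₀ ∪ S₀⁻¹`. -/
def PropertyHPlus (A : ArtinData S) : Prop :=
  ∀ (S₀ : Set S) (w : Word S), wbar A w ∈ parab A S₀ →
    ∃ w₀ : Word S, WordOver S₀ w₀ ∧ Steps012Star A w w₀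

/-- Property `H#` with respect to an `S`-sequence of transversals `T`. -/
def PropertyHSharpWrt (A : ArtinData S) (T : Set S → Set (ArtinGroup A)) : Prop :=
  (∀ S₀ : Set S, IsLeftTransversal (parab A S₀) (T S₀)) ∧
    ∀ (S' S₀ : Set S) (w : Word S), wbar A w ∈ parab A S' →
      ∃ v u : Word S, WordOver S' v ∧ WordOver (S' ∩ S₀) u ∧
        Steps012 A w (v ++ u) ∧ wbar A v ∈ T S₀

/-- Property `H#`: property `H#` with respect to some `S`-sequence of transversals. -/
def PropertyHSharp (A : ArtinData S) : Prop :=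
  ∃ T : Set S → Set (ArtinGroup A), PropertyHSharpWrt A T

/-! ### Critical words and the involution τ (relative to a dihedral pair) -/

/-- The permutation `δ` induced by conjugation by `Δ`, extended letterwise to words:
the identity if `M` is even, and the swap of `s` and `t` if `M` is odd. -/
noncomputable def deltaMap (s t : S) (M : ℕ) (w : Word S) : Word S :=
  if Even M then w
  else w.map fun l => (if l.1 = s then t else if l.1 = t then s else l.1, l.2)

/-- `w` is an unsigned critical word (of the dihedral pair `{s,t}` with label `M`) and
`w' = τ(w)`. -/
def UCritTauPair (A : ArtinData S) (s t : S) (M : ℕ) (w w' : Word S) : Prop :=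
  WordOver {s, t} w ∧ FreelyReduced w ∧ Unsigned w ∧ GeodesicOver A {s, t} w ∧
  pfun M w + nfun M w = M ∧
  ∃ (x y z z' : S) (wm : Word S),
    ({x, y} : Set S) = {s, t} ∧ ({z, z'} : Set S) = {s, t} ∧
    ((w = altWord x y (pfun M w) ++ wm ++ wordInv (altWord z z' (nfun M w)) ∧
      w' = wordInv (altWordR x y (nfun M w)) ++ deltaMap s t M wm ++
        altWordR z z' (pfun M w)) ∨
     (w = wordInv (altWordR x y (nfun M w)) ++ wm ++ altWordR z z' (pfun M w) ∧
      w' = altWord x y (pfun M w) ++ deltaMap s t M wm ++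
        wordInv (altWord z z' (nfun M w))))

/-- `w` is a positive critical word (of the dihedral pair `{s,t}` with label `M`) and
`w' = τ(w)`. -/
def PosCritTauPair (A : ArtinData S) (s t : S) (M : ℕ) (w w' : Word S) : Prop :=
  WordOver {s, t} w ∧ Positive w ∧ pfun M w = M ∧
  ∃ (x y : S) (wm : Word S), ({x, y} : Set S) = {s, t} ∧ pfun M wm < M ∧
    ((w = altWord x y M ++ wm ∧
      (w' = deltaMap s t M wm ++ altWordR x y M ∨
       w' = deltaMap s t M wm ++ altWordR y x M) ∧
      w'.getLast? ≠ w.getLast?) ∨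
     (w = wm ++ altWordR x y M ∧
      (w' = altWord x y M ++ deltaMap s t M wm ∨
       w' = altWord y x M ++ deltaMap s t M wm) ∧
      w'.head? ≠ w.head?))

/-- `w` is a negative critical word and `w' = τ(w)` (defined via formal inverses). -/
def NegCritTauPair (A : ArtinData S) (s t : S) (M : ℕ) (w w' : Word S) : Prop :=
  PosCritTauPair A s t M (wordInv w) (wordInv w')

/-- `w` is a critical word (unsigned, positive or negative) and `w' = τ(w)`. -/
def CritTauPair (A : ArtinData S) (s t : S) (M : ℕ) (w w' : Word S) : Prop :=
  UCritTauPair A s t M w w' ∨ PosCritTauPair A s t M w w' ∨ NegCritTauPair A s t M w w'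

/-- A type β transformation relative to the dihedral pair `{s,t}` with label `M`:
replace a critical factor `v` by `τ(v)`. -/
def StepBetaPair (A : ArtinData S) (s t : S) (M : ℕ) (w w' : Word S) : Prop :=
  ∃ (w₁ w₂ v v' : Word S), w = w₁ ++ v ++ w₂ ∧ w' = w₁ ++ v' ++ w₂ ∧
    CritTauPair A s t M v v'

/-- A type β transformation (in an Artin–Tits group): a type β transformation relative to some
dihedral standard parabolic subgroup (a pair of generators with finite label). -/
def StepBeta (A : ArtinData S) (w w' : Word S) : Prop :=
  ∃ (s t : S) (M : ℕ), s ≠ t ∧ A.m s t = (M : ℕ∞) ∧ StepBetaPair A s t M w w'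

/-! ### Restriction, direct products, Coxeter graph notions -/

/-- The Artin–Tits presentation induced on a subset `T` of the generators (the presentation of
the standard parabolic subgroup `A_T`). -/
def ArtinData.restrict (A : ArtinData S) (T : Set S) : ArtinData T where
  m a b := A.m a b
  symm a b := A.symm a b
  two_le a b h := A.two_le a b fun h' => h (Subtype.ext h')

/-- The Artin–Tits presentation on the disjoint union `S₁ ⊕ S₂` obtained from presentations on
`S₁` and `S₂` by adding the commuting relations `s₁s₂ = s₂s₁` (label `2`) for `s₁ ∈ S₁`,
`s₂ ∈ S₂`. -/
def prodData {S₁ S₂ : Type*} (A₁ : ArtinData S₁) (A₂ : ArtinData S₂) :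
    ArtinData (S₁ ⊕ S₂) where
  m x y :=
    match x, y with
    | Sum.inl a, Sum.inl b => A₁.m a b
    | Sum.inr a, Sum.inr b => A₂.m a b
    | _, _ => 2
  symm x y := by
    cases x <;> cases y
    · exact A₁.symm _ _
    · rfl
    · rfl
    · exact A₂.symm _ _
  two_le x y h := by
    cases x <;> cases y
    · exact A₁.two_le _ _ fun h' => h (congrArg Sum.inl h')
    · exact le_rfl
    · exact le_rfl
    · exact A₂.two_le _ _ fun h' => h (congrArg Sum.inr h')

/-- Adjacency in the Coxeter graph `Γ` restricted to `T`: distinct vertices of `T` joined by an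
edge (i.e. with label `≠ 2`, edges labelled `2` being removed in `Γ`). -/
def coxAdj (A : ArtinData S) (T : Set S) (x y : S) : Prop :=
  x ∈ T ∧ y ∈ T ∧ x ≠ y ∧ A.m x y ≠ 2

/-- The full subgraph of the Coxeter graph on the vertex subset `T` is connected. -/
def CoxConnected (A : ArtinData S) (T : Set S) : Prop :=
  ∀ x ∈ T, ∀ y ∈ T, Relation.ReflTransGen (coxAdj A T) x y

/-- The relator set of the Coxeter presentation on `T`: the Artin relations together with the
squares of the generators. -/
def coxRels (A : ArtinData S) (T : Set S) : Set (FreeGroup T) :=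
  rels (A.restrict T) ∪ {g | ∃ x : T, g = FreeGroup.of x * FreeGroup.of x}

/-- The induced presentation on `T` is of spherical type: its Coxeter group is finite. -/
def SphericalType (A : ArtinData S) (T : Set S) : Prop :=
  Finite (PresentedGroup (coxRels A T))

/-- The induced presentation on `T` is of large type: all labels are `≥ 3` (possibly `∞`). -/
def LargeTypeOn (A : ArtinData S) (T : Set S) : Prop :=
  ∀ x ∈ T, ∀ y ∈ T, x ≠ y → 3 ≤ A.m x y

/-! ### Alternating words over a two-letter alphabet -/

/-- `σ` is the transposition of a two-letter alphabet. -/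
structure IsFlip (σ : Equiv.Perm S) : Prop where
  ne : ∀ x, σ x ≠ x
  eq_or : ∀ x y, y = x ∨ y = σ x

/-- The alternating word `x, σ x, x, …` with `n` letters. -/
def alt (σ : Equiv.Perm S) (x : S) : ℕ → List S
  | 0 => []
  | n + 1 => x :: alt σ (σ x) n

variable {σ : Equiv.Perm S}

namespace IsFlip

theorem sq (hσ : IsFlip σ) : σ ^ 2 = 1 := by
  ext x
  rcases hσ.eq_or (σ x) x with h | h
  · exact absurd h.symm (hσ.ne x)
  · simpa [pow_two] using h.symm

theorem apply_apply (hσ : IsFlip σ) (x : S) : σ (σ x) = x := by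
  simpa [pow_two] using Equiv.congr_fun hσ.sq x

theorem eq_of_ne (hσ : IsFlip σ) {x y : S} (h : y ≠ x) : y = σ x :=
  (hσ.eq_or x y).resolve_left h

theorem pow_congr (hσ : IsFlip σ) {m n : ℕ} (h : m % 2 = n % 2) (x : S) :
    (σ ^ m) x = (σ ^ n) x := by
  rw [pow_eq_pow_mod m hσ.sq, pow_eq_pow_mod n hσ.sq, h]

end IsFlip

@[simp] theorem alt_length (x : S) (n : ℕ) : (alt σ x n).length = n := by
  induction n generalizing x with
  | zero => rfl
  | succ n ih => simp [alt, ih]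

theorem alt_add (x : S) (m n : ℕ) : alt σ x (m + n) = alt σ x m ++ alt σ ((σ ^ m) x) n := by
  induction m generalizing x with
  | zero => simp [alt]
  | succ m ih =>
    rw [Nat.add_right_comm]
    simp [alt, ih, pow_succ]

theorem alt_succ (x : S) (n : ℕ) : alt σ x (n + 1) = alt σ x n ++ [(σ ^ n) x] := by
  rw [alt_add]
  rfl

theorem alt_map_pow (x : S) (n : ℕ) (k : ℤ) :
    (alt σ x n).map (σ ^ k) = alt σ ((σ ^ k) x) n := by
  induction n generalizing x with
  | zero => rfl
  | succ n ih =>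
    have h : σ ((σ ^ k) x) = (σ ^ k) (σ x) := by
      rw [← Equiv.Perm.mul_apply, ← Equiv.Perm.mul_apply, (Commute.self_zpow σ k).eq]
    simp only [alt, List.map_cons, ih, h]

theorem IsFlip.alt_reverse (hσ : IsFlip σ) (x : S) (n : ℕ) :
    (alt σ x n).reverse = alt σ ((σ ^ (n + 1)) x) n := by
  induction n generalizing x with
  | zero => rfl
  | succ n ih =>
    rw [alt_succ, List.reverse_append, ih, alt]
    simp only [List.reverse_singleton, List.singleton_append]
    rw [hσ.pow_congr (show (n + 1 + 1) % 2 = n % 2 by omega), pow_succ']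
    rfl

/-- Every list starts with a maximal alternating prefix with prescribed first letter. -/
theorem exists_alt_append (l : List S) (z : S) :
    ∃ j l₀, l = alt σ z j ++ l₀ ∧ l₀.head? ≠ some ((σ ^ j) z) := by
  induction l generalizing z with
  | nil => exact ⟨0, [], by simp [alt]⟩
  | cons x l ih =>
    by_cases h : x = z
    · obtain ⟨j, l₀, h₁, h₂⟩ := ih (σ z)
      exact ⟨j + 1, l₀, by simp [alt, h, h₁], by simpa [pow_succ] using h₂⟩
    · exact ⟨0, x :: l, by simp [alt], by simpa using h⟩

/-- No factor of `l` is alternating of length `M`. -/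
def DeltaFree (σ : Equiv.Perm S) (M : ℕ) (l : List S) : Prop :=
  ∀ x, ¬ alt σ x M <:+: l

section DeltaFree

variable {M : ℕ}

theorem DeltaFree.mono {l l' : List S} (h : DeltaFree σ M l) (hl : l' <:+: l) :
    DeltaFree σ M l' :=
  fun x hx => h x (hx.trans hl)

theorem deltaFree_nil (hM : 0 < M) : DeltaFree σ M ([] : List S) := by
  intro x hx
  have := hx.length_le
  simp at this
  omega

theorem DeltaFree.reverse (hσ : IsFlip σ) {l : List S} (h : DeltaFree σ M l) :
    DeltaFree σ M l.reverse := by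
  intro x hx
  apply h ((σ ^ (M + 1)) x)
  rw [← hσ.alt_reverse, ← List.reverse_infix, List.reverse_reverse]
  exact hx

theorem head?_of_alt_prefix {x y : S} {a n : ℕ} {l : List S} (hn : 0 < n) (ha : n < a)
    (h : alt σ x a <+: alt σ y n ++ l) : l.head? = some ((σ ^ n) y) := by
  obtain ⟨b, rfl⟩ := Nat.exists_eq_add_of_lt ha
  obtain ⟨n, rfl⟩ := Nat.exists_eq_add_of_lt hn
  have hxy : x = y := by
    have h' := h
    rw [show 0 + n + 1 + b + 1 = (n + b + 1) + 1 by omega, Nat.zero_add] at h'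
    simp only [alt, List.cons_append, List.cons_prefix_cons] at h'
    exact h'.1
  subst hxy
  rw [Nat.add_assoc, alt_add, List.prefix_append_right_inj] at h
  obtain ⟨r, rfl⟩ := h
  simp [alt]

theorem DeltaFree.alt_append {l : List S} (h : DeltaFree σ M l) {n : ℕ} (hn : n < M) (y : S)
    (hb : 0 < n → l.head? ≠ some ((σ ^ n) y)) : DeltaFree σ M (alt σ y n ++ l) := by
  induction n generalizing y with
  | zero => simpa [alt] using h
  | succ n ih =>
    intro x hx
    rw [alt, List.cons_append, List.infix_cons_iff] at hx
    rcases hx with hx | hx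
    · exact hb (Nat.succ_pos n) (head?_of_alt_prefix (Nat.succ_pos n) hn hx)
    · refine ih (by omega) (σ y) (fun _ => ?_) x hx
      simpa [pow_succ] using hb (Nat.succ_pos n)

end DeltaFree

/-! ### The action on normal forms -/

section Action

variable {M : ℕ}

/-- Normal forms `Δ^k l`, with `l` a positive word without factor `Δ`. -/
abbrev NF (σ : Equiv.Perm S) (M : ℕ) := {l : List S // DeltaFree σ M l} × ℤ

/-- Left multiplication of a normal form by a generator. -/
noncomputable def step (σ : Equiv.Perm S) (M : ℕ) (x : S) (a : NF σ M) : NF σ M :=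
  if h : DeltaFree σ M ((σ ^ (M * a.2)) x :: a.1.1) then (⟨_, h⟩, a.2)
  else (⟨a.1.1.drop (M - 1), a.1.2.mono (List.drop_suffix _ _).isInfix⟩, a.2 + 1)

theorem foldr_step_of_deltaFree (w : List S) (a : NF σ M)
    (h : DeltaFree σ M (w.map (σ ^ (M * a.2)) ++ a.1.1)) :
    w.foldr (step σ M) a = (⟨_, h⟩, a.2) := by
  induction w with
  | nil => rfl
  | cons x w ih =>
    have h' := ih (h.mono (List.suffix_cons _ _).isInfix)
    rw [List.foldr_cons, h', step]
    exact dif_pos h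

theorem step_of_eq_alt (hM : 0 < M) (x : S) (a : NF σ M) {l : List S} (hl : DeltaFree σ M l)
    (h : (σ ^ (M * a.2)) x :: a.1.1 = alt σ ((σ ^ (M * a.2)) x) M ++ l) :
    step σ M x a = (⟨l, hl⟩, a.2 + 1) := by
  rw [step, dif_neg]
  · cases M with
    | zero => exact absurd hM (lt_irrefl 0)
    | succ n =>
      rw [alt, List.cons_append, List.cons_inj_right] at h
      simp [h]
  · intro hd
    exact hd _ (h ▸ (List.prefix_append _ _).isInfix)

/-- The alternating words of length `M` act as the central shift. -/
theorem foldr_step_alt (hM : 0 < M) (x : S) (a : NF σ M) :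
    (alt σ x M).foldr (step σ M) a = (a.1, a.2 + 1) := by
  obtain ⟨⟨l, hl⟩, k⟩ := a
  set y := (σ ^ (M * k)) x with hy
  obtain ⟨j, l₀, rfl, hb⟩ := exists_alt_append (σ := σ) l ((σ ^ M) y)
  have hpow : ∀ n : ℕ, (σ ^ (M * k)) ((σ ^ n) x) = (σ ^ n) y := by
    intro n
    rw [hy, ← Equiv.Perm.mul_apply, ← Equiv.Perm.mul_apply, ← zpow_natCast, ← zpow_add,
      ← zpow_add, add_comm]
  have hj : j < M := by
    by_contra hj
    obtain ⟨b, rfl⟩ := Nat.exists_eq_add_of_le (not_lt.mp hj)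
    apply hl ((σ ^ M) y)
    rw [alt_add, List.append_assoc]
    exact (List.prefix_append _ _).isInfix
  obtain ⟨i, hi⟩ := Nat.exists_eq_add_of_lt hj
  have hl₀ : DeltaFree σ M l₀ := hl.mono (List.suffix_append _ _).isInfix
  have hsplit : alt σ x M = alt σ x j ++ (σ ^ j) x :: alt σ ((σ ^ (j + 1)) x) i := by
    conv_lhs => rw [hi, Nat.add_assoc, alt_add, alt]
    rw [pow_succ', Equiv.Perm.mul_apply]
  have hmap : (alt σ ((σ ^ (j + 1)) x) i).map (σ ^ (M * k)) ++ (alt σ ((σ ^ M) y) j ++ l₀)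
      = alt σ ((σ ^ (j + 1)) y) (M - 1) ++ l₀ := by
    rw [alt_map_pow, hpow, ← List.append_assoc, show M - 1 = i + j by omega, alt_add,
      ← Equiv.Perm.mul_apply (σ ^ i), ← pow_add, show i + (j + 1) = M by omega]
  have hfree : DeltaFree σ M (alt σ ((σ ^ (j + 1)) y) (M - 1) ++ l₀) := by
    refine hl₀.alt_append (by omega) _ fun _ => ?_
    rw [← Equiv.Perm.mul_apply, ← pow_add] at hb ⊢
    rwa [show M - 1 + (j + 1) = j + M by omega]
  have hdelta : alt σ ((σ ^ j) y) M = (σ ^ j) y :: alt σ ((σ ^ (j + 1)) y) (M - 1) := by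
    conv_lhs => rw [show M = (M - 1) + 1 by omega, alt]
    rw [pow_succ', Equiv.Perm.mul_apply]
  have hshift : (alt σ x j).map (σ ^ (M * (k + 1))) = alt σ ((σ ^ M) y) j := by
    rw [alt_map_pow, hy, ← Equiv.Perm.mul_apply (σ ^ M), ← zpow_natCast, ← zpow_add]
    congr 3
    ring
  have h₁ : (alt σ ((σ ^ (j + 1)) x) i).foldr (step σ M) (⟨alt σ ((σ ^ M) y) j ++ l₀, hl⟩, k) =
      (⟨alt σ ((σ ^ (j + 1)) y) (M - 1) ++ l₀, hfree⟩, k) := by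
    rw [foldr_step_of_deltaFree _ _ (hmap.symm ▸ hfree)]
    simp only [hmap]
  have h₂ : step σ M ((σ ^ j) x) (⟨alt σ ((σ ^ (j + 1)) y) (M - 1) ++ l₀, hfree⟩, k) =
      (⟨l₀, hl₀⟩, k + 1) :=
    step_of_eq_alt hM _ _ hl₀ (by simp only [hpow, hdelta, List.cons_append])
  have h₃ : (alt σ x j).foldr (step σ M) (⟨l₀, hl₀⟩, k + 1) =
      (⟨alt σ ((σ ^ M) y) j ++ l₀, hl⟩, k + 1) := by
    rw [foldr_step_of_deltaFree _ _ (by simpa only [hshift] using hl)]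
    simp only [hshift]
  rw [hsplit, List.foldr_append, List.foldr_cons, h₁, h₂, h₃]

theorem step_bijective (hσ : IsFlip σ) (hM : 0 < M) (x : S) :
    Function.Bijective (step σ M x) := by
  obtain ⟨n, rfl⟩ := Nat.exists_eq_add_of_lt hM
  rw [Nat.zero_add] at *
  constructor
  · intro a b hab
    have key : ∀ a : NF σ (n + 1),
        (alt σ ((σ ^ n) x) n).foldr (step σ (n + 1)) (step σ (n + 1) x a) = (a.1, a.2 + 1) := by
      intro a
      have h := foldr_step_alt hM ((σ ^ n) x) a
      rwa [alt_succ, ← Equiv.Perm.mul_apply, ← pow_add,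
        hσ.pow_congr (show (n + n) % 2 = 0 % 2 by omega), pow_zero, Equiv.Perm.one_apply,
        List.foldr_append] at h
    have h := key a
    rw [hab, key b, Prod.mk.injEq] at h
    exact (Prod.ext h.1 (by omega)).symm
  · intro a
    have h := foldr_step_alt hM x (a.1, a.2 - 1)
    rw [alt, List.foldr_cons] at h
    exact ⟨_, h.trans (by simp)⟩

theorem foldr_step_one (hM : 0 < M) (b : List S) :
    0 ≤ (b.foldr (step σ M) (⟨[], deltaFree_nil hM⟩, 0)).2 ∧
      ((b.foldr (step σ M) (⟨[], deltaFree_nil hM⟩, 0)).2 = 0 →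
        (b.foldr (step σ M) (⟨[], deltaFree_nil hM⟩, 0)).1.1 = b) := by
  induction b with
  | nil => simp
  | cons x b ih =>
    rw [List.foldr_cons]
    generalize b.foldr (step σ M) (⟨[], deltaFree_nil hM⟩, 0) = a at ih ⊢
    rw [step]
    split_ifs with h
    · refine ⟨ih.1, fun h0 => ?_⟩
      replace h0 : a.2 = 0 := h0
      simp [h0, ih.2 h0]
    · exact ⟨by have := ih.1; simp only; omega, fun h0 => by have := ih.1; simp only at h0; omega⟩

end Action

/-! ### Positive words in the group -/

/-- The positive word with given letters. -/
def posWord (l : List S) : Word S := l.map fun x => (x, true)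

/-- The negative word with given letters. -/
def negWord (l : List S) : Word S := l.map fun x => (x, false)

theorem altWord_eq (hσ : IsFlip σ) (x : S) (n : ℕ) :
    altWord x (σ x) n = posWord (alt σ x n) := by
  induction n generalizing x with
  | zero => rfl
  | succ n ih =>
    have := ih (σ x)
    rw [hσ.apply_apply] at this
    rw [altWord, this]
    rfl

theorem exists_posWord {w : Word S} (hw : Positive w) : ∃ l, w = posWord l := by
  refine ⟨w.map Prod.fst, ?_⟩
  rw [posWord, List.map_map]
  conv_lhs => rw [← List.map_id w]
  exact List.map_congr_left fun a ha => Prod.ext rfl (hw a ha)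

theorem positive_posWord (l : List S) : Positive (posWord l) := by
  intro a ha
  obtain ⟨x, -, rfl⟩ := List.mem_map.1 ha
  rfl

/-- A word without factor `Δ` is the only positive word representing its element. -/
theorem eq_of_wbar_posWord_eq (A : ArtinData S) {M : ℕ} (hσ : IsFlip σ) (hM : 0 < M)
    (hA : ∀ x, A.m x (σ x) = (M : ℕ∞)) {a b : List S} (ha : DeltaFree σ M a)
    (hab : wbar A (posWord a) = wbar A (posWord b)) : a = b := by
  set f : S → Equiv.Perm (NF σ M) := fun x => Equiv.ofBijective _ (step_bijective hσ hM x) with hf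
  have hpos : ∀ l c, FreeGroup.lift f (FreeGroup.mk (posWord l)) c = l.foldr (step σ M) c := by
    intro l c
    rw [FreeGroup.lift_mk]
    induction l with
    | nil => rfl
    | cons x l ih =>
      simp only [posWord, List.map_cons, List.prod_cons, Equiv.Perm.mul_apply] at ih ⊢
      rw [ih]
      rfl
  have hrel : ∀ r ∈ rels A, FreeGroup.lift f r = 1 := by
    rintro r ⟨u, v, ⟨x, y, k, hxy, hk, rfl, rfl⟩, rfl⟩
    obtain rfl := hσ.eq_of_ne hxy.symm
    obtain rfl : M = k := by exact_mod_cast (hA x).symm.trans hk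
    rw [map_mul, map_inv, mul_inv_eq_one]
    have h := altWord_eq hσ (σ x) M
    rw [hσ.apply_apply] at h
    rw [altWord_eq hσ, h]
    ext1 c
    rw [hpos, hpos, foldr_step_alt hM, foldr_step_alt hM]
  have h : FreeGroup.lift f (FreeGroup.mk (posWord a)) =
      FreeGroup.lift f (FreeGroup.mk (posWord b)) :=
    congrArg (PresentedGroup.toGroup hrel) hab
  have h' := Equiv.congr_fun h (⟨[], deltaFree_nil hM⟩, 0)
  rw [hpos, hpos, foldr_step_of_deltaFree a _ (by simpa using ha)] at h'
  have hb := (foldr_step_one (σ := σ) hM b).2 (by rw [← h'])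
  rw [← hb, ← h']
  simp

/-! ### Evaluation of words in the group -/

theorem wbar_append (A : ArtinData S) (u v : Word S) :
    wbar A (u ++ v) = wbar A u * wbar A v := by
  rw [wbar, ← FreeGroup.mul_mk, map_mul]
  rfl

theorem wbar_wordInv (A : ArtinData S) (u : Word S) : wbar A (wordInv u) = (wbar A u)⁻¹ := by
  rw [wbar, wbar, ← map_inv, FreeGroup.inv_mk, FreeGroup.invRev, wordInv, List.map_reverse]

theorem IsRel.wbar_eq {A : ArtinData S} {u v : Word S} (h : IsRel A u v) :
    wbar A u = wbar A v := by
  have h₁ : PresentedGroup.mk (rels A) (FreeGroup.mk u * (FreeGroup.mk v)⁻¹) = 1 :=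
    PresentedGroup.one_of_mem ⟨u, v, h, rfl⟩
  rwa [map_mul, map_inv, mul_inv_eq_one] at h₁

theorem Step2rStar.wbar_eq {A : ArtinData S} {w w' : Word S} (h : Step2rStar A w w') :
    wbar A w = wbar A w' := by
  obtain ⟨w₁, w₂, v, u, v', u', hrel, -, -, rfl, rfl, -, -⟩ := h
  have h := hrel.wbar_eq
  rw [wbar_append, wbar_append] at h
  simp only [wbar_append, wbar_wordInv]
  have : (wbar A v)⁻¹ * wbar A v' = wbar A u * (wbar A u')⁻¹ := by
    rw [inv_mul_eq_iff_eq_mul, ← mul_assoc, h, mul_inv_cancel_right]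
  rw [mul_assoc (wbar A w₁), this, ← mul_assoc]

theorem wbar_eq_of_steps {A : ArtinData S} {w w' : Word S}
    (h : Relation.ReflTransGen (Step2rStar A) w w') : wbar A w = wbar A w' := by
  induction h with
  | refl => rfl
  | tail _ hs ih => exact ih.trans hs.wbar_eq

theorem isLCPrefix_append {v u z : Word S} (h : ∀ c, u.head? = some c → z.head? ≠ some c) :
    IsLCPrefix v (v ++ u) (v ++ z) := by
  refine ⟨List.prefix_append _ _, List.prefix_append _ _, fun q hu hz => ?_⟩
  by_contra! hq
  obtain ⟨r, rfl⟩ := List.prefix_of_prefix_length_le (List.prefix_append v u) hu hq.le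
  rw [List.prefix_append_right_inj] at hu hz
  obtain ⟨u', rfl⟩ := hu
  obtain ⟨z', rfl⟩ := hz
  cases r with
  | nil => simp at hq
  | cons c r => exact h c rfl rfl

theorem wordInv_negWord (l : List S) : wordInv (negWord l) = posWord l.reverse := by
  simp [wordInv, negWord, posWord, Function.comp_def]

theorem wordInv_posWord (l : List S) : wordInv (posWord l) = negWord l.reverse := by
  simp [wordInv, negWord, posWord, Function.comp_def]

theorem wordInv_head? (w : Word S) : (wordInv w).head? = w.getLast?.map fun l => (l.1, !l.2) := by
  simp [wordInv]

/-! ### Encoding of reduced words by signed lengths -/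

/-- The first letter of a syllable of sign `b` with key `p`. -/
def key (σ : Equiv.Perm S) (b : Bool) (p : S) : S := (σ ^ (cond b 0 1)) p

/-- The signed alternating word of sign `b`, key `p` and length `n`. -/
def syl (σ : Equiv.Perm S) (b : Bool) (p : S) (n : ℕ) : Word S :=
  (alt σ (key σ b p) n).map fun x => (x, b)

/-- The key following a list of syllables with initial key `p`. -/
def endKey (σ : Equiv.Perm S) : S → List (Bool × ℕ) → S
  | p, [] => p
  | p, a :: L => endKey σ ((σ ^ (a.2 + 1)) p) L

/-- The word with initial key `p` and syllables of given signs and lengths. -/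
def enc (σ : Equiv.Perm S) : S → List (Bool × ℕ) → Word S
  | _, [] => []
  | p, a :: L => syl σ a.1 p a.2 ++ enc σ ((σ ^ (a.2 + 1)) p) L

/-- All syllables are nonempty and shorter than `M`. -/
def Valid (M : ℕ) (L : List (Bool × ℕ)) : Prop := ∀ a ∈ L, 0 < a.2 ∧ a.2 < M

theorem pow_apply_pow_apply (m n : ℕ) (x : S) : (σ ^ m) ((σ ^ n) x) = (σ ^ (m + n)) x := by
  rw [pow_add, Equiv.Perm.mul_apply]

theorem enc_append (p : S) (L L' : List (Bool × ℕ)) :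
    enc σ p (L ++ L') = enc σ p L ++ enc σ (endKey σ p L) L' := by
  induction L generalizing p with
  | nil => rfl
  | cons a L ih => simp [enc, endKey, ih]

theorem endKey_append (p : S) (L L' : List (Bool × ℕ)) :
    endKey σ p (L ++ L') = endKey σ (endKey σ p L) L' := by
  induction L generalizing p with
  | nil => rfl
  | cons a L ih => simp [endKey, ih]

theorem enc_head? {M : ℕ} {p : S} {a : Bool × ℕ} {L : List (Bool × ℕ)} (hL : Valid M (a :: L)) :
    (enc σ p (a :: L)).head? = some (key σ a.1 p, a.1) := by
  obtain ⟨n, hn⟩ := Nat.exists_eq_succ_of_ne_zero (hL a List.mem_cons_self).1.ne'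
  simp [enc, syl, hn, alt]

theorem enc_getLast? {M : ℕ} (hσ : IsFlip σ) {p : S} {L : List (Bool × ℕ)} (hL : Valid M L)
    {c : S × Bool} (hc : (enc σ p L).getLast? = some c) :
    c.1 = key σ c.2 (endKey σ p L) := by
  rcases List.eq_nil_or_concat L with rfl | ⟨L, a, rfl⟩
  · simp [enc] at hc
  · rw [List.concat_eq_append] at *
    obtain ⟨n, hn⟩ := Nat.exists_eq_succ_of_ne_zero (hL a (by simp)).1.ne'
    simp only [enc_append, enc, syl, hn, Nat.succ_eq_add_one, alt_succ, List.map_append,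
      List.map_cons, List.map_nil, List.append_nil, ← List.append_assoc,
      List.getLast?_append_of_ne_nil _ (List.cons_ne_nil _ _), List.getLast?_singleton,
      Option.some_inj] at hc
    rw [← hc, endKey_append]
    simp only [endKey, key, hn, Nat.succ_eq_add_one, pow_apply_pow_apply]
    exact hσ.pow_congr (by omega) _

/-- Every freely reduced word without long alternating factors is encoded. -/
theorem exists_enc {M : ℕ} (hσ : IsFlip σ) (p₀ : S) {w : Word S} (hw : FreelyReduced w)
    (hM : ∀ b x n, ((alt σ x n).map fun y => (y, b)) <:+: w → n < M) :
    ∃ p L, Valid M L ∧ w = enc σ p L := by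
  induction w with
  | nil => exact ⟨p₀, [], by simp [Valid], rfl⟩
  | cons c w ih =>
    obtain ⟨x, b⟩ := c
    obtain ⟨p, L, hL, rfl⟩ := ih
      (fun w₁ w₂ y b' h => hw ((x, b) :: w₁) w₂ y b' (by simp [h]))
      (fun b' y n h => hM b' y n (h.trans (List.suffix_cons _ _).isInfix))
    have h1M : 1 < M := hM b x 1 ⟨[], enc σ p L, by simp [alt]⟩
    have hone : ∀ q, x = key σ b q → enc σ q L = enc σ p L →
        ∃ p' L', Valid M L' ∧ (x, b) :: enc σ p L = enc σ p' L' := by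
      rintro q hx hq
      refine ⟨q, (b, 1) :: L, ?_, ?_⟩
      · intro a ha
        rcases List.mem_cons.1 ha with rfl | ha
        · exact ⟨Nat.one_pos, h1M⟩
        · exact hL a ha
      · simp [enc, syl, alt, hx, hσ.sq, hq]
    cases L with
    | nil =>
      refine hone (key σ b x) ?_ rfl
      rw [key, key, pow_apply_pow_apply]
      exact (hσ.pow_congr (n := 0) (by cases b <;> rfl) x).symm
    | cons a L =>
      obtain ⟨b', n⟩ := a
      by_cases hx : x = key σ b p
      · exact hone p hx rfl
      have hx' : x = key σ b (σ p) := by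
        rw [hσ.eq_of_ne hx, key, key, ← Equiv.Perm.mul_apply, ← Equiv.Perm.mul_apply,
          ← pow_succ, ← pow_succ']
      obtain rfl : b' = b := by
        by_contra hb
        obtain rfl : b' = !b := by simpa using (Bool.eq_not_of_ne hb)
        have hxk : x = key σ (!b) p := by
          rw [hx', key, key, ← Equiv.Perm.mul_apply, ← pow_succ]
          exact hσ.pow_congr (by cases b <;> rfl) p
        have hh := enc_head? (σ := σ) (p := p) hL
        rw [← hxk] at hh
        obtain ⟨w', hw'⟩ := List.head?_eq_some_iff.1 hh
        exact hw [] w' x b (by simp [hw'])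
      have hcons : (x, b') :: enc σ p ((b', n) :: L) = enc σ (σ p) ((b', n + 1) :: L) := by
        have h₁ : σ x = key σ b' p := by
          rw [hσ.eq_of_ne hx, hσ.apply_apply]
        have h₂ : (σ ^ (n + 1 + 1)) (σ p) = (σ ^ (n + 1)) p := by
          rw [← Equiv.Perm.mul_apply, ← pow_succ]
          exact hσ.pow_congr (by omega) p
        simp only [enc, syl, alt, List.map_cons, List.cons_append, h₂, ← hx', h₁]
      refine ⟨σ p, (b', n + 1) :: L, ?_, hcons⟩
      intro a ha
      rcases List.mem_cons.1 ha with rfl | ha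
      · refine ⟨Nat.succ_pos n, hM b' (key σ b' (σ p)) (n + 1) ?_⟩
        rw [hcons]
        exact (List.prefix_append _ _).isInfix
      · exact hL a (List.mem_cons_of_mem _ ha)

/-! ### Sorting the signs -/

/-- The effect of a type 2r⋆ transformation on the list of syllables. -/
def SylStep (M : ℕ) (L L' : List (Bool × ℕ)) : Prop :=
  ∃ L₁ L₂ a b, L = L₁ ++ (false, a) :: (true, b) :: L₂ ∧
    L' = L₁ ++ (true, M - a) :: (false, M - b) :: L₂

theorem SylStep.cons {M : ℕ} {L L' : List (Bool × ℕ)} (h : SylStep M L L') (c : Bool × ℕ) :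
    SylStep M (c :: L) (c :: L') := by
  obtain ⟨L₁, L₂, a, b, rfl, rfl⟩ := h
  exact ⟨c :: L₁, L₂, a, b, rfl, rfl⟩

theorem SylStep.valid {M : ℕ} {L L' : List (Bool × ℕ)} (h : SylStep M L L') (hL : Valid M L) :
    Valid M L' := by
  obtain ⟨L₁, L₂, a, b, rfl, rfl⟩ := h
  have ha : 0 < a ∧ a < M := hL (false, a) (by simp)
  have hb : 0 < b ∧ b < M := hL (true, b) (by simp)
  intro c hc
  simp only [List.mem_append, List.mem_cons] at hc
  rcases hc with hc | rfl | rfl | hc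
  · exact hL c (by simp [hc])
  · exact ⟨by simp only; omega, by simp only; omega⟩
  · exact ⟨by simp only; omega, by simp only; omega⟩
  · exact hL c (by simp [hc])

theorem exists_push {M : ℕ} (ps : List ℕ) (R : List (Bool × ℕ)) (a : ℕ) :
    ∃ (ps' : List ℕ) (a' : ℕ), Relation.ReflTransGen (SylStep M) ((false, a) :: (ps.map (Prod.mk true) ++ R))
      (ps'.map (Prod.mk true) ++ (false, a') :: R) := by
  induction ps generalizing a with
  | nil => exact ⟨[], a, .refl⟩
  | cons b ps ih =>
    obtain ⟨ps', a', h⟩ := ih (M - b)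
    refine ⟨(M - a) :: ps', a', .head ⟨[], _, a, b, rfl, rfl⟩ ?_⟩
    exact h.lift (List.cons (true, M - a)) fun _ _ hs => hs.cons _

theorem exists_sort {M : ℕ} (L : List (Bool × ℕ)) :
    ∃ ps ns : List ℕ, Relation.ReflTransGen (SylStep M) L
      (ps.map (Prod.mk true) ++ ns.map (Prod.mk false)) := by
  induction L with
  | nil => exact ⟨[], [], .refl⟩
  | cons c L ih =>
    obtain ⟨ps, ns, h⟩ := ih
    have h' := h.lift (List.cons c) fun _ _ hs => SylStep.cons hs c
    obtain ⟨b, n⟩ := c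
    cases b with
    | true => exact ⟨n :: ps, ns, h'⟩
    | false =>
      obtain ⟨ps', a, hp⟩ := exists_push (M := M) ps (ns.map (Prod.mk false)) n
      exact ⟨ps', a :: ns, h'.trans hp⟩

theorem SylStep.step2rStar {A : ArtinData S} {M : ℕ} (hσ : IsFlip σ)
    (hA : ∀ x, A.m x (σ x) = (M : ℕ∞)) (p : S) {L L' : List (Bool × ℕ)} (h : SylStep M L L')
    (hL : Valid M L) : Step2rStar A (enc σ p L) (enc σ p L') := by
  obtain ⟨L₁, L₂, a, b, rfl, rfl⟩ := h
  have ha : 0 < a ∧ a < M := hL (false, a) (by simp)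
  have hb : 0 < b ∧ b < M := hL (true, b) (by simp)
  have hL₁ : Valid M L₁ := fun c hc => hL c (by simp [hc])
  have hL₂ : Valid M L₂ := fun c hc => hL c (by simp [hc])
  set q := endKey σ p L₁ with hq
  have hkey : (σ ^ (M - b + 1)) ((σ ^ (M - a + 1)) q) = (σ ^ (b + 1)) ((σ ^ (a + 1)) q) := by
    rw [pow_apply_pow_apply, pow_apply_pow_apply]
    exact hσ.pow_congr (by omega) q
  have hv : wordInv (posWord (alt σ ((σ ^ a) q) a)) = syl σ false q a := by
    rw [wordInv_posWord, hσ.alt_reverse, pow_apply_pow_apply,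
      hσ.pow_congr (show (a + 1 + a) % 2 = 1 % 2 by omega)]
    rfl
  have hu' : wordInv (posWord (alt σ ((σ ^ (a + 1 + b)) q) (M - b))) =
      syl σ false ((σ ^ (M - a + 1)) q) (M - b) := by
    rw [wordInv_posWord, hσ.alt_reverse, syl, key, pow_apply_pow_apply, pow_apply_pow_apply,
      hσ.pow_congr (show (M - b + 1 + (a + 1 + b)) % 2 = (1 + (M - a + 1)) % 2 by omega)]
    rfl
  have hvu : alt σ ((σ ^ a) q) a ++ alt σ q (M - a) = alt σ ((σ ^ a) q) M := by
    conv_rhs => rw [show M = a + (M - a) by omega, alt_add, pow_apply_pow_apply,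
      hσ.pow_congr (show (a + a) % 2 = 0 % 2 by omega)]
    rfl
  have hvu' : alt σ ((σ ^ (a + 1)) q) b ++ alt σ ((σ ^ (a + 1 + b)) q) (M - b) =
      alt σ (σ ((σ ^ a) q)) M := by
    conv_rhs => rw [show M = b + (M - b) by omega, alt_add]
    rw [← Equiv.Perm.mul_apply σ, ← pow_succ', pow_apply_pow_apply, add_comm b]
  refine ⟨enc σ p L₁, enc σ ((σ ^ (b + 1)) ((σ ^ (a + 1)) q)) L₂, posWord (alt σ ((σ ^ a) q) a),
    posWord (alt σ q (M - a)), posWord (alt σ ((σ ^ (a + 1)) q) b),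
    posWord (alt σ ((σ ^ (a + 1 + b)) q) (M - b)), ?_, ?_, ?_, ?_, ?_, ?_, ?_⟩
  · refine ⟨(σ ^ a) q, σ ((σ ^ a) q), M, (hσ.ne _).symm, hA _, ?_, ?_⟩
    · rw [altWord_eq hσ, ← hvu]
      simp [posWord]
    · have h := altWord_eq hσ (σ ((σ ^ a) q)) M
      rw [hσ.apply_apply] at h
      rw [h, ← hvu']
      simp [posWord]
  · exact fun h => ha.1.ne' (by simpa [posWord] using congrArg List.length h)
  · exact fun h => hb.1.ne' (by simpa [posWord] using congrArg List.length h)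
  · rw [hv, enc_append, ← hq]
    simp only [enc, List.append_assoc]
    rfl
  · rw [hu', enc_append, ← hq]
    simp only [enc, List.append_assoc, hkey]
    rfl
  · apply isLCPrefix_append
    intro c hc hc'
    obtain ⟨n, hn⟩ := Nat.exists_eq_add_of_lt ha.2
    rw [show M - a = n + 1 by omega] at hc
    obtain rfl : (q, true) = c := by simpa [posWord, alt] using hc
    rw [wordInv_head?] at hc'
    obtain ⟨d, hd, hd'⟩ := Option.map_eq_some_iff.1 hc'
    have hlast := enc_getLast? hσ hL₁ hd
    obtain ⟨x, e⟩ := d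
    simp only [Prod.mk.injEq, Bool.not_eq_true'] at hd' hlast
    rw [hd'.1, hd'.2, ← hq] at hlast
    exact hσ.ne q hlast.symm
  · apply isLCPrefix_append
    intro c hc hc'
    obtain ⟨n, hn⟩ := Nat.exists_eq_add_of_lt hb.2
    rw [show M - b = n + 1 by omega] at hc
    obtain rfl : ((σ ^ (a + 1 + b)) q, true) = c := by simpa [posWord, alt] using hc
    cases L₂ with
    | nil => simp [enc] at hc'
    | cons d L₂ =>
      rw [enc_head? hL₂, Option.some_inj, Prod.mk.injEq] at hc'
      rw [hc'.2, pow_apply_pow_apply] at hc'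
      have h := hc'.1
      rw [key, cond_true, pow_zero, Equiv.Perm.one_apply,
        show b + 1 + (a + 1) = (a + 1 + b) + 1 by omega, pow_succ'] at h
      exact hσ.ne _ h

theorem steps_enc {A : ArtinData S} {M : ℕ} (hσ : IsFlip σ)
    (hA : ∀ x, A.m x (σ x) = (M : ℕ∞)) (p : S) {L L' : List (Bool × ℕ)}
    (h : Relation.ReflTransGen (SylStep M) L L') (hL : Valid M L) :
    Valid M L' ∧ Relation.ReflTransGen (Step2rStar A) (enc σ p L) (enc σ p L') := by
  induction h with
  | refl => exact ⟨hL, .refl⟩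
  | tail _ hs ih => exact ⟨hs.valid ih.1, ih.2.tail (hs.step2rStar hσ hA p ih.1)⟩

/-! ### Syllables of constant sign -/

/-- The letters of a word with syllables of constant sign and first letter `q`. -/
def letters (σ : Equiv.Perm S) : S → List ℕ → List S
  | _, [] => []
  | q, n :: ns => alt σ q n ++ letters σ ((σ ^ (n + 1)) q) ns

theorem enc_map (b : Bool) (p : S) (ns : List ℕ) :
    enc σ p (ns.map (Prod.mk b)) = (letters σ (key σ b p) ns).map fun x => (x, b) := by
  induction ns generalizing p with
  | nil => rfl
  | cons n ns ih =>
    have h : key σ b ((σ ^ (n + 1)) p) = (σ ^ (n + 1)) (key σ b p) := by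
      rw [key, key, pow_apply_pow_apply, pow_apply_pow_apply, add_comm]
    rw [List.map_cons, enc, ih, h, letters, List.map_append]
    rfl

theorem letters_head? {q c : S} {ns : List ℕ} (hns : ∀ n ∈ ns, 0 < n)
    (h : (letters σ q ns).head? = some c) : c = q := by
  cases ns with
  | nil => simp [letters] at h
  | cons n ns =>
    obtain ⟨k, rfl⟩ := Nat.exists_eq_succ_of_ne_zero (hns n List.mem_cons_self).ne'
    simpa [letters, alt, eq_comm] using h

theorem deltaFree_letters {M : ℕ} (hσ : IsFlip σ) (hM : 0 < M) (q : S) {ns : List ℕ}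
    (hns : ∀ n ∈ ns, 0 < n ∧ n < M) : DeltaFree σ M (letters σ q ns) := by
  induction ns generalizing q with
  | nil => exact deltaFree_nil hM
  | cons n ns ih =>
    have hns' : ∀ n ∈ ns, 0 < n ∧ n < M := fun k hk => hns k (List.mem_cons_of_mem _ hk)
    refine (ih _ hns').alt_append (hns n List.mem_cons_self).2 q fun _ h => ?_
    have h' := letters_head? (fun k hk => (hns' k hk).1) h
    rw [pow_succ'] at h'
    exact hσ.ne _ h'.symm

/-! ### Words in `Ω` -/

theorem squareFree_posWord_alt (hσ : IsFlip σ) (x : S) (n : ℕ) :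
    SquareFree (posWord (alt σ x n)) := by
  induction n generalizing x with
  | zero => intro a h; simpa [posWord, alt] using h.length_le
  | succ n ih =>
    intro a h
    rw [alt, posWord, List.map_cons, List.infix_cons_iff] at h
    rcases h with h | h
    · cases n with
      | zero => simpa [alt] using h.length_le
      | succ n =>
        simp only [alt, List.map_cons, List.cons_prefix_cons] at h
        exact hσ.ne x (congrArg Prod.fst (h.2.1.symm.trans h.1))
    · exact ih (σ x) a h

theorem length_lt_of_omega {M : ℕ} (hσ : IsFlip σ) {w : Word S} (hw : Omega M w) (b : Bool)
    (x : S) (n : ℕ) (h : ((alt σ x n).map fun y => (y, b)) <:+: w) : n < M := by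
  obtain ⟨hp, hn⟩ := max_lt_iff.1 hw.2
  rw [pfun, min_lt_iff, or_iff_left (lt_irrefl M)] at hp
  rw [nfun, min_lt_iff, or_iff_left (lt_irrefl M)] at hn
  cases b with
  | true =>
    refine lt_of_le_of_lt (le_csSup ⟨w.length, ?_⟩ ?_) hp
    · rintro k ⟨v, hv, -, -, rfl⟩
      exact hv.length_le
    · exact ⟨_, h, positive_posWord _, squareFree_posWord_alt hσ x n, by simp⟩
  | false =>
    refine lt_of_le_of_lt (le_csSup ⟨w.length, ?_⟩ ?_) hn
    · rintro k ⟨v, hv, -, -, rfl⟩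
      exact hv.length_le
    · refine ⟨_, h, ?_, ?_, by simp⟩
      · intro a ha
        obtain ⟨y, -, rfl⟩ := List.mem_map.1 ha
        rfl
      · have := wordInv_negWord (alt σ x n)
        rw [negWord] at this
        rw [this, hσ.alt_reverse]
        exact squareFree_posWord_alt hσ _ n

theorem isFlip_swap {s t : S} (hst : s ≠ t) (hdih : ∀ x : S, x = s ∨ x = t) :
    IsFlip (Equiv.swap s t) where
  ne x := by
    rcases hdih x with rfl | rfl
    · simpa using hst.symm
    · simpa using hst
  eq_or x y := by
    rcases hdih x with rfl | rfl <;> rcases hdih y with rfl | rfl <;> simp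

/-- Proposition 2.11: in a dihedral Artin–Tits group with `m < ∞`, every
`w ∈ Ω(Γ₀)` can be transformed by `→_{2⋆}` into `w₁ w₂⁻¹` where `w₁, w₂` are positive words
representing the two terms of the left normal decomposition of `w̄`. -/
theorem stmt5 {S : Type*} [Finite S] (A : ArtinData S) (s t : S) (M : ℕ)
    (hst : s ≠ t) (hdih : ∀ x : S, x = s ∨ x = t) (hM : A.m s t = (M : ℕ∞))
    (w : Word S) (hΩ : Omega M w) (g₁ g₂ : ArtinGroup A)
    (hp1 : IsPosElt A g₁) (hp2 : IsPosElt A g₂)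
    (hdec : wbar A w = g₁ * g₂⁻¹)
    (hnf : ∀ h₁ h₂ : ArtinGroup A, IsPosElt A h₁ → IsPosElt A h₂ →
      wbar A w = h₁ * h₂⁻¹ →
      ∃ h : ArtinGroup A, IsPosElt A h ∧ h₁ = g₁ * h ∧ h₂ = g₂ * h) :
    ∃ w₁ w₂ : Word S, Positive w₁ ∧ Positive w₂ ∧
      wbar A w₁ = g₁ ∧ wbar A w₂ = g₂ ∧ Steps2Star A w (w₁ ++ wordInv w₂) := by
  have hσ := isFlip_swap hst hdih
  set σ := Equiv.swap s t
  have hA : ∀ x, A.m x (σ x) = (M : ℕ∞) := by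
    intro x
    rcases hdih x with rfl | rfl
    · rw [Equiv.swap_apply_left, hM]
    · rw [Equiv.swap_apply_right, A.symm, hM]
  have hM0 : 0 < M := by
    have h : ((2 : ℕ) : ℕ∞) ≤ M := hM ▸ A.two_le s t hst
    exact Nat.pos_of_ne_zero fun h0 => by subst h0; simp at h
  obtain ⟨p, L, hL, rfl⟩ := exists_enc hσ s hΩ.1 (length_lt_of_omega hσ hΩ)
  obtain ⟨ps, ns, hsort⟩ := exists_sort (M := M) L
  obtain ⟨hval, hsteps⟩ := steps_enc hσ hA p hsort hL
  have hps : Valid M (ps.map (Prod.mk true)) := fun a ha => hval a (by simp [ha])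
  have hps' : ∀ n ∈ ps, 0 < n ∧ n < M := fun n hn => hps (true, n) (by simp [hn])
  have hns : ∀ n ∈ ns, 0 < n ∧ n < M := fun n hn => hval (false, n) (by simp [hn])
  have hlast := fun c => enc_getLast? hσ (p := p) hps (c := c)
  set q := endKey σ p (ps.map (Prod.mk true)) with hq
  rw [enc_append, ← hq, enc_map false] at hsteps
  rw [enc_map true] at hsteps hlast
  set a := letters σ (key σ true p) ps
  set b := letters σ (key σ false q) ns with hb
  have ha_free : DeltaFree σ M a := deltaFree_letters hσ hM0 _ hps'
  have hb_free : DeltaFree σ M b.reverse := (deltaFree_letters hσ hM0 _ hns).reverse hσ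
  have hsteps' : Relation.ReflTransGen (Step2rStar A) (enc σ p L)
      (posWord a ++ wordInv (posWord b.reverse)) := by
    rw [wordInv_posWord, List.reverse_reverse]
    exact hsteps
  have heq : wbar A (enc σ p L) = wbar A (posWord a) * (wbar A (posWord b.reverse))⁻¹ := by
    rw [← wbar_wordInv, ← wbar_append]
    exact wbar_eq_of_steps hsteps'
  obtain ⟨h, ⟨r, hr, rfl⟩, h₁, h₂⟩ := hnf _ _ ⟨_, positive_posWord a, rfl⟩
    ⟨_, positive_posWord b.reverse, rfl⟩ heq
  obtain ⟨c₁, hc₁, rfl⟩ := hp1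
  obtain ⟨c₂, hc₂, rfl⟩ := hp2
  obtain ⟨r, rfl⟩ := exists_posWord hr
  obtain ⟨c₁, rfl⟩ := exists_posWord hc₁
  obtain ⟨c₂, rfl⟩ := exists_posWord hc₂
  have hap : ∀ u v : List S, posWord u ++ posWord v = posWord (u ++ v) := by simp [posWord]
  have e₁ : a = c₁ ++ r := by
    apply eq_of_wbar_posWord_eq A hσ hM0 hA ha_free
    rw [h₁, ← wbar_append, hap]
  have e₂ : b.reverse = c₂ ++ r := by
    apply eq_of_wbar_posWord_eq A hσ hM0 hA hb_free
    rw [h₂, ← wbar_append, hap]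
  obtain rfl : r = [] := by
    rcases List.eq_nil_or_concat r with rfl | ⟨r, c, rfl⟩
    · rfl
    · exfalso
      have hcq : c = q := hlast (c, true) (by simp [e₁])
      have hbh : b.head? = some c := by
        rw [← List.getLast?_reverse, e₂]
        simp
      have hcb : c = σ q := letters_head? (fun n hn => (hns n hn).1) hbh
      exact hσ.ne q (hcb.symm.trans hcq)
  rw [List.append_nil] at e₁ e₂
  refine ⟨posWord a, posWord b.reverse, positive_posWord _, positive_posWord _, by rw [e₁],
    by rw [e₂], ?_⟩
  exact Relation.ReflTransGen.mono (fun _ _ h => Or.inl h) _ _ hsteps'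

end ArtinTits
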